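/- arXiv:1612.05584 — 7 statements merged into one kernel-verified Lean document; each statement's English description precedes it below -/
import Mathlib

section
/- Let g : [a,b] → ℝ be continuous on a compact interval [a,b] with a ≤ b, and define u(x) = S⁰(g)(x) = max{ min{ g(y) : y ∈ [x,b] }, min{ g(y) : y ∈ [a,x] } }. Then u is quasiconvex on [a,b] (i.e., u(t·x + (1−t)·y) ≤ max{u(x), u(y)} for all x, y ∈ [a,b] and t ∈ [0,1]), u ≤ g on [a,b], and u(a) = g(a), u(b) = g(b). -/
/-- The infimum of `g` over `[x, b]` is monotone in `x`. -/
theorem monotoneOn_sInf_image_Icc_right {a b : ℝ} {g : ℝ → ℝ}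
    (hg : BddBelow (g '' Set.Icc a b)) :
    MonotoneOn (fun x => sInf (g '' Set.Icc x b)) (Set.Icc a b) := fun _ hx _ hy hxy =>
  csInf_le_csInf (hg.mono (Set.image_mono (Set.Icc_subset_Icc_left hx.1)))
    ((Set.nonempty_Icc.2 hy.2).image g) (Set.image_mono (Set.Icc_subset_Icc_left hxy))

/-- The infimum of `g` over `[a, x]` is antitone in `x`. -/
theorem antitoneOn_sInf_image_Icc_left {a b : ℝ} {g : ℝ → ℝ}
    (hg : BddBelow (g '' Set.Icc a b)) :
    AntitoneOn (fun x => sInf (g '' Set.Icc a x)) (Set.Icc a b) := fun _ hx _ hy hxy =>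
  csInf_le_csInf (hg.mono (Set.image_mono (Set.Icc_subset_Icc_right hy.2)))
    ((Set.nonempty_Icc.2 hx.1).image g) (Set.image_mono (Set.Icc_subset_Icc_right hxy))

/-- For `g` continuous on `[a,b]`, the function
`u(x) = max { min_{y ∈ [x,b]} g(y), min_{y ∈ [a,x]} g(y) }` is quasiconvex on `[a,b]`,
satisfies `u ≤ g` on `[a,b]`, and `u(a) = g(a)`, `u(b) = g(b)`. -/
theorem S0_is_quasiconvex_below_g (a b : ℝ) (hab : a ≤ b) (g : ℝ → ℝ)
    (hg : ContinuousOn g (Set.Icc a b))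
    (u : ℝ → ℝ) (hu : ∀ x : ℝ, u x = max (sInf (g '' Set.Icc x b)) (sInf (g '' Set.Icc a x))) :
    (∀ x ∈ Set.Icc a b, ∀ y ∈ Set.Icc a b, ∀ t ∈ Set.Icc (0:ℝ) 1,
      u (t * x + (1 - t) * y) ≤ max (u x) (u y)) ∧
    (∀ x ∈ Set.Icc a b, u x ≤ g x) ∧
    u a = g a ∧ u b = g b := by
  have hbdd : BddBelow (g '' Set.Icc a b) := (isCompact_Icc.image_of_continuousOn hg).bddBelow
  have hquasi : QuasiconvexOn ℝ (Set.Icc a b) u := by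
    rw [funext hu]
    exact ((monotoneOn_sInf_image_Icc_right hbdd).quasiconvexOn (convex_Icc a b)).sup
      ((antitoneOn_sInf_image_Icc_left hbdd).quasiconvexOn (convex_Icc a b))
  have hle : ∀ x ∈ Set.Icc a b, u x ≤ g x := fun x hx => by
    rw [hu]
    exact max_le
      (csInf_le (hbdd.mono (Set.image_mono (Set.Icc_subset_Icc_left hx.1)))
        (Set.mem_image_of_mem g (Set.left_mem_Icc.2 hx.2)))
      (csInf_le (hbdd.mono (Set.image_mono (Set.Icc_subset_Icc_right hx.2)))
        (Set.mem_image_of_mem g (Set.right_mem_Icc.2 hx.1)))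
  refine ⟨fun x hx y hy t ht => ?_, hle, ?_, ?_⟩
  · exact (quasiconvexOn_iff_le_max.1 hquasi).2 hx hy ht.1 (sub_nonneg.2 ht.2)
      (add_sub_cancel t 1)
  · refine (hle a (Set.left_mem_Icc.2 hab)).antisymm ?_
    simp [hu]
  · refine (hle b (Set.right_mem_Icc.2 hab)).antisymm ?_
    simp [hu]
end

section
/- Let g : [a,b] → ℝ be continuous on a compact interval [a,b] with a ≤ b, and define S⁰(g)(x) = max{ min{ g(y) : y ∈ [x,b] }, min{ g(y) : y ∈ [a,x] } }. Then S⁰(g) is the quasiconvex envelope of g: for every quasiconvex function v : [a,b] → ℝ with v ≤ g on [a,b], one has v ≤ S⁰(g) on [a,b]; consequently S⁰(g)(x) = sup{ v(x) : v quasiconvex on [a,b], v ≤ g on [a,b] } for every x ∈ [a,b]. -/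
/-- A function `v` is quasiconvex on the interval `[a,b]`. -/
def QuasiconvexOnIcc (a b : ℝ) (v : ℝ → ℝ) : Prop :=
  ∀ x ∈ Set.Icc a b, ∀ y ∈ Set.Icc a b, ∀ t ∈ Set.Icc (0:ℝ) 1,
    v (t * x + (1 - t) * y) ≤ max (v x) (v y)

/-- A function that is pointwise the maximum of a monotone and an antitone function on `[a,b]` is
quasiconvex there. -/
theorem quasiconvexOnIcc_max {a b : ℝ} {p q : ℝ → ℝ} (hp : MonotoneOn p (Set.Icc a b))
    (hq : AntitoneOn q (Set.Icc a b)) : QuasiconvexOnIcc a b (fun x => max (p x) (q x)) := by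
  intro x hx y hy t ht
  have hz : t * x + (1 - t) * y ∈ Set.Icc a b :=
    convex_Icc a b hx hy ht.1 (sub_nonneg.2 ht.2) (by ring)
  have hxy : t * x + (1 - t) * y ∈ Set.uIcc x y :=
    convex_uIcc x y Set.left_mem_uIcc Set.right_mem_uIcc ht.1 (sub_nonneg.2 ht.2) (by ring)
  rcases Set.mem_uIcc.1 hxy with h | h
  · exact max_le (le_max_of_le_right (le_max_of_le_left (hp hz hy h.2)))
      (le_max_of_le_left (le_max_of_le_right (hq hx hz h.1)))
  · exact max_le (le_max_of_le_left (le_max_of_le_left (hp hz hx h.2)))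
      (le_max_of_le_right (le_max_of_le_right (hq hy hz h.1)))

/-- A quasiconvex minorant of `g` lies below the larger of the one-sided infima of `g`. -/
theorem QuasiconvexOnIcc.le_max_sInf {a b : ℝ} {g v : ℝ → ℝ} (hv : QuasiconvexOnIcc a b v)
    (hvg : ∀ y ∈ Set.Icc a b, v y ≤ g y) {x : ℝ} (hx : x ∈ Set.Icc a b) :
    v x ≤ max (sInf (g '' Set.Icc x b)) (sInf (g '' Set.Icc a x)) := by
  by_contra! h
  obtain ⟨hr, hl⟩ := max_lt_iff.1 h
  obtain ⟨_, ⟨y, hy, rfl⟩, hyv⟩ :=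
    exists_lt_of_csInf_lt ((Set.nonempty_Icc.2 hx.2).image g) hr
  obtain ⟨_, ⟨z, hz, rfl⟩, hzv⟩ :=
    exists_lt_of_csInf_lt ((Set.nonempty_Icc.2 hx.1).image g) hl
  have hy' : y ∈ Set.Icc a b := ⟨hx.1.trans hy.1, hy.2⟩
  have hz' : z ∈ Set.Icc a b := ⟨hz.1, hz.2.trans hx.2⟩
  have hseg : x ∈ segment ℝ z y := by
    rw [segment_eq_Icc (hz.2.trans hy.1)]
    exact ⟨hz.2, hy.1⟩
  obtain ⟨s, t, hs, ht, hst, hxe⟩ := hseg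
  have hmax := hv z hz' y hy' s ⟨hs, by linarith⟩
  rw [show 1 - s = t by linarith, show s * z + t * y = x from hxe] at hmax
  exact absurd hmax (not_le.2 (max_lt ((hvg z hz').trans_lt hzv) ((hvg y hy').trans_lt hyv)))

/-- For `g` continuous on `[a,b]`,
`S⁰(g)(x) = max { min_{y ∈ [x,b]} g(y), min_{y ∈ [a,x]} g(y) }` is the quasiconvex
envelope of `g`: every quasiconvex `v ≤ g` satisfies `v ≤ S⁰(g)` on `[a,b]`, and
consequently `S⁰(g)(x)` equals the pointwise supremum of such functions. -/
theorem S0_is_quasiconvex_envelope (a b : ℝ) (hab : a ≤ b) (g : ℝ → ℝ)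
    (hg : ContinuousOn g (Set.Icc a b))
    (S0 : ℝ → ℝ)
    (hS0 : ∀ x : ℝ, S0 x = max (sInf (g '' Set.Icc x b)) (sInf (g '' Set.Icc a x))) :
    (∀ v : ℝ → ℝ, QuasiconvexOnIcc a b v → (∀ y ∈ Set.Icc a b, v y ≤ g y) →
      ∀ x ∈ Set.Icc a b, v x ≤ S0 x) ∧
    (∀ x ∈ Set.Icc a b,
      S0 x = sSup {r : ℝ | ∃ v : ℝ → ℝ, QuasiconvexOnIcc a b v ∧
        (∀ y ∈ Set.Icc a b, v y ≤ g y) ∧ v x = r}) := by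
  have hbdd : BddBelow (g '' Set.Icc a b) := isCompact_Icc.bddBelow_image hg
  have hmin : ∀ v : ℝ → ℝ, QuasiconvexOnIcc a b v → (∀ y ∈ Set.Icc a b, v y ≤ g y) →
      ∀ x ∈ Set.Icc a b, v x ≤ S0 x := by
    intro v hv hvg x hx
    rw [hS0]
    exact hv.le_max_sInf hvg hx
  have hr : ∀ x ∈ Set.Icc a b, BddBelow (g '' Set.Icc x b) := fun x hx =>
    hbdd.mono (Set.image_mono (Set.Icc_subset_Icc_left hx.1))
  have hl : ∀ x ∈ Set.Icc a b, BddBelow (g '' Set.Icc a x) := fun x hx =>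
    hbdd.mono (Set.image_mono (Set.Icc_subset_Icc_right hx.2))
  have hqc : QuasiconvexOnIcc a b S0 := by
    rw [show S0 = _ from funext hS0]
    refine quasiconvexOnIcc_max (fun x hx y hy hxy => ?_) (fun x hx y hy hxy => ?_)
    · exact csInf_le_csInf (hr x hx) ((Set.nonempty_Icc.2 hy.2).image g)
        (Set.image_mono (Set.Icc_subset_Icc_left hxy))
    · exact csInf_le_csInf (hl y hy) ((Set.nonempty_Icc.2 hx.1).image g)
        (Set.image_mono (Set.Icc_subset_Icc_right hxy))
  have hle : ∀ y ∈ Set.Icc a b, S0 y ≤ g y := by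
    intro y hy
    rw [hS0]
    exact max_le (csInf_le (hr y hy) ⟨y, Set.left_mem_Icc.2 hy.2, rfl⟩)
      (csInf_le (hl y hy) ⟨y, Set.right_mem_Icc.2 hy.1, rfl⟩)
  refine ⟨hmin, fun x hx => Eq.symm (IsGreatest.csSup_eq (And.intro ⟨S0, hqc, hle, rfl⟩ ?_))⟩
  rintro _ ⟨v, hv, hvg, rfl⟩
  exact hmin v hv hvg x hx
end

section
/- Let g : [a,b] → ℝ be continuous on a compact interval [a,b] with a ≤ b, and let u(x) = max{ min{ g(y) : y ∈ [x,b] }, min{ g(y) : y ∈ [a,x] } } be its quasiconvex envelope. If y ∈ [a,b] satisfies u(y) < g(y), then there exist points c, d with a ≤ c < y < d ≤ b such that u is constant on [c,d] and u(c) = g(c) and u(d) = g(d). -/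
/-- The last point of `[p, y]` at which `g` takes a level `l` with `g p ≤ l < g y`. -/
theorem exists_last_eq_of_le_of_lt {g : ℝ → ℝ} {p y l : ℝ} (hpy : p ≤ y)
    (hg : ContinuousOn g (Set.Icc p y)) (hp : g p ≤ l) (hl : l < g y) :
    ∃ c, p ≤ c ∧ c < y ∧ g c = l ∧ ∀ w, c ≤ w → w ≤ y → l ≤ g w := by
  have hS : IsCompact (Set.Icc p y ∩ g ⁻¹' Set.Iic l) :=
    isCompact_Icc.of_isClosed_subset
      (hg.preimage_isClosed_of_isClosed isClosed_Icc isClosed_Iic) Set.inter_subset_left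
  obtain ⟨c, ⟨⟨hpc, hcy⟩, hgc⟩, hmax⟩ :=
    hS.exists_isGreatest ⟨p, Set.left_mem_Icc.2 hpy, hp⟩
  obtain ⟨x, ⟨hcx, hxy⟩, hx⟩ := intermediate_value_Icc hcy
    (hg.mono (Set.Icc_subset_Icc_left hpc)) ⟨hgc, hl.le⟩
  have hxc : x = c := le_antisymm (hmax ⟨⟨hpc.trans hcx, hxy⟩, hx.le⟩) hcx
  rw [hxc] at hx
  refine ⟨c, hpc, lt_of_le_of_ne hcy ?_, hx, fun w hcw hwy => ?_⟩
  · rintro rfl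
    exact hl.ne' hx
  · by_contra! h
    have hwc : w = c := le_antisymm (hmax ⟨⟨hpc.trans hcw, hwy⟩, h.le⟩) hcw
    rw [hwc, hx] at h
    exact h.false

/-- The first point of `[y, q]` at which `g` takes a level `l` with `g q ≤ l < g y`. -/
theorem exists_first_eq_of_le_of_lt {g : ℝ → ℝ} {y q l : ℝ} (hyq : y ≤ q)
    (hg : ContinuousOn g (Set.Icc y q)) (hq : g q ≤ l) (hl : l < g y) :
    ∃ d, y < d ∧ d ≤ q ∧ g d = l ∧ ∀ w, y ≤ w → w ≤ d → l ≤ g w := by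
  obtain ⟨c, hqc, hcy, hc, hmin⟩ := exists_last_eq_of_le_of_lt (g := fun x => g (-x))
    (neg_le_neg hyq)
    (hg.comp continuous_neg.continuousOn fun x hx =>
      ⟨le_neg.1 hx.2, neg_le.1 hx.1⟩) (by simpa using hq) (by simpa using hl)
  refine ⟨-c, lt_neg.1 hcy, neg_le.1 hqc, hc, fun w hyw hwc => ?_⟩
  simpa using hmin (-w) (le_neg.1 hwc) (neg_le_neg hyw)

/-- For `g` continuous on `[a,b]` with quasiconvex envelope
`u(x) = max { min_{y ∈ [x,b]} g(y), min_{y ∈ [a,x]} g(y) }`: if `u(y) < g(y)` for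
some `y ∈ [a,b]`, then there exist `c, d` with `a ≤ c < y < d ≤ b`, `u` constant
on `[c,d]`, `u(c) = g(c)` and `u(d) = g(d)`. -/
theorem qce_flat_part (a b : ℝ) (hab : a ≤ b) (g : ℝ → ℝ)
    (hg : ContinuousOn g (Set.Icc a b))
    (u : ℝ → ℝ)
    (hu : ∀ x : ℝ, u x = max (sInf (g '' Set.Icc x b)) (sInf (g '' Set.Icc a x)))
    (y : ℝ) (hy : y ∈ Set.Icc a b) (hlt : u y < g y) :
    ∃ c d : ℝ, a ≤ c ∧ c < y ∧ y < d ∧ d ≤ b ∧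
      (∀ z ∈ Set.Icc c d, ∀ w ∈ Set.Icc c d, u z = u w) ∧
      u c = g c ∧ u d = g d := by
  obtain ⟨hay, hyb⟩ := hy
  obtain ⟨p, ⟨hap, hpy⟩, hp⟩ := isCompact_Icc.exists_isMinOn (Set.nonempty_Icc.2 hay)
    (hg.mono (Set.Icc_subset_Icc_right hyb))
  obtain ⟨q, ⟨hyq, hqb⟩, hq⟩ := isCompact_Icc.exists_isMinOn (Set.nonempty_Icc.2 hyb)
    (hg.mono (Set.Icc_subset_Icc_left hay))
  rw [isMinOn_iff] at hp hq
  have hL (z : ℝ) (hpz : p ≤ z) (h : ∀ w ∈ Set.Icc a z, g p ≤ g w) :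
      sInf (g '' Set.Icc a z) = g p :=
    IsLeast.csInf_eq ⟨⟨p, ⟨hap, hpz⟩, rfl⟩, Set.forall_mem_image.2 h⟩
  have hR (z : ℝ) (hzq : z ≤ q) (h : ∀ w ∈ Set.Icc z b, g q ≤ g w) :
      sInf (g '' Set.Icc z b) = g q :=
    IsLeast.csInf_eq ⟨⟨q, ⟨hzq, hqb⟩, rfl⟩, Set.forall_mem_image.2 h⟩
  have huy : u y = max (g q) (g p) := by rw [hu, hL y hpy hp, hR y hyq hq]
  have hpu : g p ≤ u y := huy ▸ le_max_right _ _
  have hqu : g q ≤ u y := huy ▸ le_max_left _ _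
  obtain ⟨c, hpc, hcy, hgc, hcmin⟩ := exists_last_eq_of_le_of_lt hpy
    (hg.mono (Set.Icc_subset_Icc hap hyb)) hpu hlt
  obtain ⟨d, hyd, hdq, hgd, hdmin⟩ := exists_first_eq_of_le_of_lt hyq
    (hg.mono (Set.Icc_subset_Icc hay hqb)) hqu hlt
  have hconst : ∀ z ∈ Set.Icc c d, u z = u y := by
    rintro z ⟨hcz, hzd⟩
    rw [hu z, huy, hL z (hpc.trans hcz), hR z (hzd.trans hdq)]
    · rintro w ⟨hzw, hwb⟩
      rcases le_total y w with h | h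
      · exact hq w ⟨h, hwb⟩
      · exact hqu.trans (hcmin w (hcz.trans hzw) h)
    · rintro w ⟨haw, hwz⟩
      rcases le_total w y with h | h
      · exact hp w ⟨haw, h⟩
      · exact hpu.trans (hdmin w h (hwz.trans hzd))
  have hcd : c ≤ d := (hcy.trans hyd).le
  exact ⟨c, d, hap.trans hpc, hcy, hyd, hdq.trans hqb,
    fun z hz w hw => (hconst z hz).trans (hconst w hw).symm,
    (hconst c (Set.left_mem_Icc.2 hcd)).trans hgc.symm,
    (hconst d (Set.right_mem_Icc.2 hcd)).trans hgd.symm⟩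
end

section
/- Let u : ℝ → ℝ be continuous and quasiconvex, let x* be a global minimizer of u, and let x > x*. If φ : ℝ → ℝ is differentiable at x and u − φ has a local maximum at x, then φ′(x) ≥ 0. Symmetrically, if x < x* and u − φ has a local maximum at x, then φ′(x) ≤ 0. -/
open Filter Topology in
theorem HasDerivAt.nonneg_of_eventually_le_right {f : ℝ → ℝ} {f' x : ℝ} (hf : HasDerivAt f f' x)
    (h : ∀ᶠ y in 𝓝[>] x, f x ≤ f y) : 0 ≤ f' := by
  have ht := (hasDerivWithinAt_iff_tendsto_slope' (s := Set.Ioi x) (lt_irrefl x)).1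
    hf.hasDerivWithinAt
  refine ge_of_tendsto ht ?_
  filter_upwards [h, self_mem_nhdsWithin] with y hy hxy
  rw [slope_def_field]
  exact div_nonneg (sub_nonneg.2 hy) (sub_nonneg.2 (le_of_lt hxy))

open Filter Topology in
theorem HasDerivAt.nonpos_of_eventually_le_left {f : ℝ → ℝ} {f' x : ℝ} (hf : HasDerivAt f f' x)
    (h : ∀ᶠ y in 𝓝[<] x, f x ≤ f y) : f' ≤ 0 := by
  have ht := (hasDerivWithinAt_iff_tendsto_slope' (s := Set.Iio x) (lt_irrefl x)).1
    hf.hasDerivWithinAt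
  refine le_of_tendsto ht ?_
  filter_upwards [h, self_mem_nhdsWithin] with y hy hxy
  rw [slope_def_field]
  exact div_nonpos_of_nonneg_of_nonpos (sub_nonneg.2 hy) (sub_nonpos.2 (le_of_lt hxy))

/-- Let `u : ℝ → ℝ` be continuous and quasiconvex with global
minimizer `xs`.  If `x > xs`, `φ` is differentiable at `x`, and `u − φ` has a local
maximum at `x`, then `φ'(x) ≥ 0`.  Symmetrically, if `x < xs` then `φ'(x) ≤ 0`. -/
theorem quasiconvex_viscosity_subsolution (u : ℝ → ℝ) (hu : Continuous u)
    (hqc : ∀ x y : ℝ, ∀ t ∈ Set.Icc (0:ℝ) 1, u (t * x + (1 - t) * y) ≤ max (u x) (u y))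
    (xs : ℝ) (hmin : ∀ x : ℝ, u xs ≤ u x) :
    (∀ x : ℝ, xs < x → ∀ φ : ℝ → ℝ, DifferentiableAt ℝ φ x →
      IsLocalMax (fun y => u y - φ y) x → 0 ≤ deriv φ x) ∧
    (∀ x : ℝ, x < xs → ∀ φ : ℝ → ℝ, DifferentiableAt ℝ φ x →
      IsLocalMax (fun y => u y - φ y) x → deriv φ x ≤ 0) := by
  have le_of_mem_segment : ∀ x y : ℝ, x ∈ segment ℝ xs y → u x ≤ u y := by
    rintro x y ⟨a, b, ha, hb, hab, rfl⟩
    have h := hqc xs y a ⟨ha, by linarith⟩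
    rw [max_eq_right (hmin y), ← eq_sub_of_add_eq' hab] at h
    exact h
  refine ⟨fun x hx φ hφ hmax => hφ.hasDerivAt.nonneg_of_eventually_le_right ?_,
    fun x hx φ hφ hmax => hφ.hasDerivAt.nonpos_of_eventually_le_left ?_⟩
  · filter_upwards [hmax.filter_mono nhdsWithin_le_nhds, self_mem_nhdsWithin] with y hy hxy
    have hxy : x < y := hxy
    have := le_of_mem_segment x y (by
      rw [segment_eq_Icc (hx.trans hxy).le]
      exact ⟨hx.le, hxy.le⟩)
    linarith
  · filter_upwards [hmax.filter_mono nhdsWithin_le_nhds, self_mem_nhdsWithin] with y hy hxy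
    have hxy : y < x := hxy
    have := le_of_mem_segment x y (by
      rw [segment_symm, segment_eq_Icc (hxy.trans hx).le]
      exact ⟨hxy.le, hx.le⟩)
    linarith
end

section
/- Let g : ℝⁿ → ℝ be bounded below and let d ∈ ℝⁿ be a unit vector. Define u(x) = max{ inf{ g(x + t·d) : t ≥ 0 }, inf{ g(x + t·d) : t ≤ 0 } }. Then: (i) u ≤ g; (ii) u is quasiconvex along every line with direction d, i.e., for each x₀ the function t ↦ u(x₀ + t·d) is quasiconvex on ℝ; and (iii) u is the d-quasiconvex envelope of g: every function v : ℝⁿ → ℝ with v ≤ g that is quasiconvex along every line with direction d satisfies v ≤ u. -/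
/-- A one-variable function `w : ℝ → ℝ` is quasiconvex. -/
def QuasiconvexLine (w : ℝ → ℝ) : Prop :=
  ∀ s r : ℝ, ∀ t ∈ Set.Icc (0:ℝ) 1, w (t * s + (1 - t) * r) ≤ max (w s) (w r)

theorem quasiconvexLine_iff_le_max_of_mem_Icc {w : ℝ → ℝ} :
    QuasiconvexLine w ↔ ∀ a b, ∀ p ∈ Set.Icc a b, w p ≤ max (w a) (w b) := by
  constructor
  · rintro h a b p ⟨hap, hpb⟩
    obtain ⟨α, β, hα, hβ, hαβ, rfl⟩ := (Convex.mem_Icc (hap.trans hpb)).1 ⟨hap, hpb⟩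
    have := h a b α ⟨hα, by linarith⟩
    rwa [show 1 - α = β by linarith] at this
  · rintro h s r t ⟨ht0, ht1⟩
    rcases le_total s r with hsr | hrs
    · exact h s r _ ⟨by nlinarith, by nlinarith⟩
    · rw [max_comm]
      exact h r s _ ⟨by nlinarith, by nlinarith⟩

theorem quasiconvexLine_max_of_monotone_of_antitone {f g : ℝ → ℝ} (hf : Monotone f)
    (hg : Antitone g) : QuasiconvexLine (fun t => max (f t) (g t)) :=
  quasiconvexLine_iff_le_max_of_mem_Icc.2 fun _ _ _ hp =>
    max_le (le_max_of_le_right (le_max_of_le_left (hf hp.2)))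
      (le_max_of_le_left (le_max_of_le_right (hg hp.1)))

theorem le_max_sInf_image_of_quasiconvexLine {w f : ℝ → ℝ} (hw : QuasiconvexLine w)
    (hwf : ∀ t, w t ≤ f t) (s : ℝ) :
    w s ≤ max (sInf (f '' Set.Ici s)) (sInf (f '' Set.Iic s)) := by
  by_contra! h
  obtain ⟨h₁, h₂⟩ := max_lt_iff.1 h
  obtain ⟨_, ⟨b, hb, rfl⟩, hbs⟩ := exists_lt_of_csInf_lt (Set.nonempty_Ici.image f) h₁
  obtain ⟨_, ⟨a, ha, rfl⟩, has⟩ := exists_lt_of_csInf_lt (Set.nonempty_Iic.image f) h₂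
  have hmax := quasiconvexLine_iff_le_max_of_mem_Icc.1 hw a b s ⟨ha, hb⟩
  exact (hmax.trans (max_le_max (hwf a) (hwf b))).not_gt (max_lt has hbs)

/-- for `g : ℝⁿ → ℝ` bounded below, `d` a unit vector, and
`u(x) = max { inf_{t ≥ 0} g(x + t•d), inf_{t ≤ 0} g(x + t•d) }`:
(i) `u ≤ g`; (ii) `u` is quasiconvex along every line with direction `d`; and
(iii) `u` is the `d`-quasiconvex envelope of `g`: every `v ≤ g` which is
quasiconvex along every line of direction `d` satisfies `v ≤ u`. -/
theorem directional_QCE (n : ℕ) (g : EuclideanSpace ℝ (Fin n) → ℝ)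
    (hg : BddBelow (Set.range g))
    (d : EuclideanSpace ℝ (Fin n)) (hd : ‖d‖ = 1)
    (u : EuclideanSpace ℝ (Fin n) → ℝ)
    (hu : ∀ x, u x = max (sInf ((fun t => g (x + t • d)) '' Set.Ici (0:ℝ)))
                        (sInf ((fun t => g (x + t • d)) '' Set.Iic (0:ℝ)))) :
    (∀ x, u x ≤ g x) ∧
    (∀ x₀ : EuclideanSpace ℝ (Fin n), QuasiconvexLine (fun t => u (x₀ + t • d))) ∧
    (∀ v : EuclideanSpace ℝ (Fin n) → ℝ, (∀ x, v x ≤ g x) →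
      (∀ x₀ : EuclideanSpace ℝ (Fin n), QuasiconvexLine (fun t => v (x₀ + t • d))) →
      ∀ x, v x ≤ u x) := by
  have hbdd : ∀ x (S : Set ℝ), BddBelow ((fun t => g (x + t • d)) '' S) := fun x S =>
    hg.mono (by rintro _ ⟨t, -, rfl⟩; exact ⟨_, rfl⟩)
  refine ⟨fun x => ?_, fun x₀ => ?_, fun v hvg hv x => ?_⟩
  · rw [hu]
    exact max_le (csInf_le (hbdd x _) ⟨0, Set.self_mem_Ici, by simp⟩)
      (csInf_le (hbdd x _) ⟨0, Set.self_mem_Iic, by simp⟩)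
  · have key : ∀ (s : ℝ) (S : Set ℝ), (fun t => g (x₀ + s • d + t • d)) '' S =
        (fun t => g (x₀ + t • d)) '' ((fun t => s + t) '' S) := fun s S => by
      simp only [Set.image_image, add_smul, add_assoc]
    simp only [hu, key, Set.image_const_add_Ici, Set.image_const_add_Iic, add_zero]
    refine quasiconvexLine_max_of_monotone_of_antitone (fun a b hab => ?_) (fun a b hab => ?_)
    · exact csInf_le_csInf (hbdd _ _) (Set.nonempty_Ici.image _)
        (Set.image_mono (Set.Ici_subset_Ici.2 hab))
    · exact csInf_le_csInf (hbdd _ _) (Set.nonempty_Iic.image _)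
        (Set.image_mono (Set.Iic_subset_Iic.2 hab))
  · rw [hu]
    simpa using le_max_sInf_image_of_quasiconvexLine (hv x) (fun t => hvg (x + t • d)) 0
end

section
/- Let g : ℝⁿ → ℝ be bounded below, let D = {d₁, …, d_k} be a finite set of unit vectors in ℝⁿ, and for each unit vector d define the operator S^d by S^d(f)(x) = max{ inf{ f(x + t·d) : t ≥ 0 }, inf{ f(x + t·d) : t ≤ 0 } }. Let S^D = S^{d_k} ∘ ⋯ ∘ S^{d₁}, and define iterates u⁰ = g, uⁿ = S^D(uⁿ⁻¹). Then the iterates are decreasing, uⁿ⁺¹ ≤ uⁿ ≤ g, and satisfy QC^D(g) ≤ uⁿ for all n; moreover, the pointwise limit W(x) = limₙ uⁿ(x) exists and equals the D-quasiconvex envelope: W = QC^D(g). -/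
/-- `u` is `D`-quasiconvex: quasiconvex along every line with direction in `D`. -/
def DQuasiconvex (n : ℕ) (D : Set (EuclideanSpace ℝ (Fin n)))
    (u : EuclideanSpace ℝ (Fin n) → ℝ) : Prop :=
  ∀ x₀ : EuclideanSpace ℝ (Fin n), ∀ d ∈ D, QuasiconvexLine (fun t => u (x₀ + t • d))

/-- The directional solution operator
`S^d(f)(x) = max { inf_{t ≥ 0} f(x + t•d), inf_{t ≤ 0} f(x + t•d) }`. -/
noncomputable def Sdir (n : ℕ) (d : EuclideanSpace ℝ (Fin n))
    (f : EuclideanSpace ℝ (Fin n) → ℝ) : EuclideanSpace ℝ (Fin n) → ℝ :=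
  fun x => max (sInf ((fun t => f (x + t • d)) '' Set.Ici (0:ℝ)))
               (sInf ((fun t => f (x + t • d)) '' Set.Iic (0:ℝ)))

/-- `S^D = S^{d_k} ∘ ⋯ ∘ S^{d₁}` for the finite list of directions `d₁, …, d_k`. -/
noncomputable def SD (n k : ℕ) (d : Fin k → EuclideanSpace ℝ (Fin n))
    (f : EuclideanSpace ℝ (Fin n) → ℝ) : EuclideanSpace ℝ (Fin n) → ℝ :=
  (List.ofFn d).foldl (fun f di => Sdir n di f) f

section DirectionalOperator

variable {n : ℕ} {e : EuclideanSpace ℝ (Fin n)} {f h v : EuclideanSpace ℝ (Fin n) → ℝ}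

theorem bddBelow_line_image (hf : BddBelow (Set.range f)) (x : EuclideanSpace ℝ (Fin n))
    (s : Set ℝ) : BddBelow ((fun t : ℝ => f (x + t • e)) '' s) :=
  hf.mono (by rintro _ ⟨t, -, rfl⟩; exact ⟨_, rfl⟩)

theorem Sdir_le_max (hf : BddBelow (Set.range f)) (x : EuclideanSpace ℝ (Fin n)) {s t : ℝ}
    (ht : 0 ≤ t) (hs : s ≤ 0) : Sdir n e f x ≤ max (f (x + t • e)) (f (x + s • e)) :=
  max_le_max (csInf_le (bddBelow_line_image hf x _) ⟨t, ht, rfl⟩)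
    (csInf_le (bddBelow_line_image hf x _) ⟨s, hs, rfl⟩)

theorem Sdir_le_self (hf : BddBelow (Set.range f)) : Sdir n e f ≤ f := fun x => by
  simpa using Sdir_le_max (e := e) hf x (le_refl 0) (le_refl 0)

theorem Sdir_mono (hf : BddBelow (Set.range f)) (hfh : f ≤ h) : Sdir n e f ≤ Sdir n e h := by
  have key (x : EuclideanSpace ℝ (Fin n)) {s : Set ℝ} (hs : s.Nonempty) :
      sInf ((fun t : ℝ => f (x + t • e)) '' s) ≤ sInf ((fun t : ℝ => h (x + t • e)) '' s) := by
    refine le_csInf (hs.image _) ?_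
    rintro _ ⟨t, ht, rfl⟩
    exact (csInf_le (bddBelow_line_image hf x _) ⟨t, ht, rfl⟩).trans (hfh _)
  exact fun x => max_le_max (key x Set.nonempty_Ici) (key x Set.nonempty_Iic)

/-- A function quasiconvex along a line through `x` lies below the max of its values on
either side of `x`. -/
theorem QuasiconvexLine.le_max_of_nonneg_of_nonpos {w : ℝ → ℝ} (hw : QuasiconvexLine w) {s t : ℝ}
    (ht : 0 ≤ t) (hs : s ≤ 0) : w 0 ≤ max (w t) (w s) := by
  rcases (hs.trans ht).eq_or_lt with hst | hst
  · obtain rfl : t = 0 := by linarith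
    exact le_max_left _ _
  · have hpos : 0 < t - s := sub_pos.mpr hst
    have := hw t s (-s / (t - s))
      ⟨div_nonneg (by linarith) hpos.le, (div_le_one hpos).mpr (by linarith)⟩
    rwa [show -s / (t - s) * t + (1 - -s / (t - s)) * s = 0 by field_simp; ring] at this

theorem le_Sdir {D : Set (EuclideanSpace ℝ (Fin n))} (hv : DQuasiconvex n D v) (he : e ∈ D)
    (hvf : v ≤ f) : v ≤ Sdir n e f := by
  intro x
  by_contra! hlt
  obtain ⟨hlt₁, hlt₂⟩ := max_lt_iff.mp hlt
  obtain ⟨_, ⟨t, ht, rfl⟩, hft⟩ := exists_lt_of_csInf_lt (Set.nonempty_Ici.image _) hlt₁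
  obtain ⟨_, ⟨s, hs, rfl⟩, hfs⟩ := exists_lt_of_csInf_lt (Set.nonempty_Iic.image _) hlt₂
  have hmax := (hv x e he).le_max_of_nonneg_of_nonpos ht hs
  simp only [zero_smul, add_zero] at hmax
  exact absurd hmax (not_le.mpr (max_lt ((hvf _).trans_lt hft) ((hvf _).trans_lt hfs)))

theorem DQuasiconvex.const (D : Set (EuclideanSpace ℝ (Fin n))) (c : ℝ) :
    DQuasiconvex n D (fun _ => c) :=
  fun _ _ _ _ _ _ _ => le_max_left _ _

theorem bddBelow_Sdir (hf : BddBelow (Set.range f)) : BddBelow (Set.range (Sdir n e f)) := by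
  obtain ⟨c, hc⟩ := hf
  refine ⟨c, ?_⟩
  rintro _ ⟨x, rfl⟩
  exact le_Sdir (DQuasiconvex.const {e} c) rfl (fun y => hc ⟨y, rfl⟩) x

theorem le_foldl_Sdir {D : Set (EuclideanSpace ℝ (Fin n))} (hv : DQuasiconvex n D v)
    (l : List (EuclideanSpace ℝ (Fin n))) (hl : ∀ a ∈ l, a ∈ D) (hvf : v ≤ f) :
    v ≤ l.foldl (fun f a => Sdir n a f) f := by
  induction l generalizing f with
  | nil => exact hvf
  | cons a l ih =>
    simp only [List.mem_cons, forall_eq_or_imp] at hl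
    exact ih hl.2 (le_Sdir hv hl.1 hvf)

theorem foldl_Sdir_le_self (l : List (EuclideanSpace ℝ (Fin n))) (hf : BddBelow (Set.range f)) :
    l.foldl (fun f a => Sdir n a f) f ≤ f := by
  induction l generalizing f with
  | nil => exact le_refl f
  | cons a l ih => exact (ih (bddBelow_Sdir hf)).trans (Sdir_le_self hf)

theorem foldl_Sdir_le_Sdir (l : List (EuclideanSpace ℝ (Fin n))) (hf : BddBelow (Set.range f))
    (he : e ∈ l) : l.foldl (fun f a => Sdir n a f) f ≤ Sdir n e f := by
  induction l generalizing f with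
  | nil => simp at he
  | cons a l ih =>
    rcases List.mem_cons.mp he with rfl | hel
    · exact foldl_Sdir_le_self l (bddBelow_Sdir hf)
    · exact (ih (bddBelow_Sdir hf) hel).trans (Sdir_mono (bddBelow_Sdir hf) (Sdir_le_self hf))

/-- One application of `S^e` bounds the value at a convex combination of two points of a line
by the larger of the two endpoint values. -/
theorem Sdir_convex_comb_le (hf : BddBelow (Set.range f)) (x : EuclideanSpace ℝ (Fin n))
    (s r : ℝ) {t : ℝ} (ht : t ∈ Set.Icc (0 : ℝ) 1) :
    Sdir n e f (x + (t * s + (1 - t) * r) • e) ≤ max (f (x + s • e)) (f (x + r • e)) := by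
  set q := t * s + (1 - t) * r with hq
  have hshift (a : ℝ) : x + q • e + (a - q) • e = x + a • e := by
    rw [add_assoc, ← add_smul, add_sub_cancel]
  obtain ⟨ht₀, ht₁⟩ := ht
  rcases le_total r s with hrs | hrs
  · have := Sdir_le_max (e := e) hf (x + q • e) (t := s - q) (s := r - q)
      (by nlinarith) (by nlinarith)
    rwa [hshift, hshift] at this
  · have := Sdir_le_max (e := e) hf (x + q • e) (t := r - q) (s := s - q)
      (by nlinarith) (by nlinarith)
    rwa [hshift, hshift, max_comm] at this

end DirectionalOperator

/-- for `g` bounded below and a finite direction set `D = {d₁,…,d_k}`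
of unit vectors, the iterates `u⁰ = g`, `uⁿ = S^D(uⁿ⁻¹)` are decreasing,
satisfy `QC^D(g) ≤ uⁿ ≤ g`, and converge pointwise to the `D`-quasiconvex
envelope `QC^D(g)`. -/
theorem line_solver_converges (n k : ℕ) (g : EuclideanSpace ℝ (Fin n) → ℝ)
    (hg : BddBelow (Set.range g))
    (d : Fin k → EuclideanSpace ℝ (Fin n)) (hd : ∀ i, ‖d i‖ = 1)
    (u : ℕ → EuclideanSpace ℝ (Fin n) → ℝ)
    (hu0 : u 0 = g) (hun : ∀ m : ℕ, u (m + 1) = SD n k d (u m))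
    (Q : EuclideanSpace ℝ (Fin n) → ℝ)
    (hQ : ∀ x, Q x = sSup {r : ℝ | ∃ v : EuclideanSpace ℝ (Fin n) → ℝ,
      DQuasiconvex n (Set.range d) v ∧ (∀ y, v y ≤ g y) ∧ v x = r}) :
    (∀ m : ℕ, ∀ x, u (m + 1) x ≤ u m x) ∧
    (∀ m : ℕ, ∀ x, u m x ≤ g x) ∧
    (∀ m : ℕ, ∀ x, Q x ≤ u m x) ∧
    (∀ x, Filter.Tendsto (fun m => u m x) Filter.atTop (nhds (Q x))) := by
  have hv_le {v : EuclideanSpace ℝ (Fin n) → ℝ} (hv : DQuasiconvex n (Set.range d) v)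
      (hvg : v ≤ g) (m : ℕ) : v ≤ u m := by
    induction m with
    | zero => rwa [hu0]
    | succ m ih =>
      rw [hun]
      exact le_foldl_Sdir hv _ (fun a ha => (List.mem_ofFn' _ _).mp ha) ih
  obtain ⟨c, hc⟩ := hg
  have hcg : (fun _ => c) ≤ g := fun y => hc ⟨y, rfl⟩
  have hcqc := DQuasiconvex.const (Set.range d) c
  have hbdd (m : ℕ) : BddBelow (Set.range (u m)) :=
    ⟨c, by rintro _ ⟨x, rfl⟩; exact hv_le hcqc hcg m x⟩
  have hstep (m : ℕ) : u (m + 1) ≤ u m := by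
    rw [hun]
    exact foldl_Sdir_le_self _ (hbdd m)
  have hanti : Antitone u := antitone_nat_of_succ_le hstep
  have hQle (m : ℕ) (x) : Q x ≤ u m x := by
    rw [hQ]
    refine csSup_le ⟨c, _, hcqc, hcg, rfl⟩ ?_
    rintro _ ⟨v, hv, hvg, rfl⟩
    exact hv_le hv hvg m x
  have hlim (x) : Filter.Tendsto (fun m => u m x) Filter.atTop (nhds (⨅ m, u m x)) :=
    tendsto_atTop_ciInf (fun _ _ hab => hanti hab x)
      ⟨c, by rintro _ ⟨m, rfl⟩; exact hv_le hcqc hcg m x⟩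
  have hug (m : ℕ) (x) : u m x ≤ g x := hu0 ▸ hanti (Nat.zero_le m) x
  have hWqc : DQuasiconvex n (Set.range d) (fun x => ⨅ m, u m x) := by
    rintro x _ ⟨i, rfl⟩ s r t ht
    refine le_of_tendsto_of_tendsto' ((hlim _).comp (Filter.tendsto_add_atTop_nat 1))
      ((hlim _).max (hlim _)) fun m => ?_
    simp only [Function.comp_apply, hun]
    exact (foldl_Sdir_le_Sdir _ (hbdd m) ((List.mem_ofFn' _ _).mpr ⟨i, rfl⟩) _).trans
      (Sdir_convex_comb_le (hbdd m) x s r ht)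
  refine ⟨hstep, hug, hQle, fun x => ?_⟩
  have hWQ : ⨅ m, u m x = Q x := by
    refine le_antisymm ?_ (le_ciInf fun m => hQle m x)
    rw [hQ]
    refine le_csSup ⟨g x, ?_⟩
      ⟨_, hWqc, fun y => le_of_tendsto' (hlim y) fun m => hug m y, rfl⟩
    rintro _ ⟨v, -, hvg, rfl⟩
    exact hvg x
  exact hWQ ▸ hlim x
end

section
/- Let N ≥ 0 and g : {0, 1, …, N} → ℝ. Define u⁻(j) = min{ g(i) : i ≤ j } and u⁺(j) = min{ g(i) : i ≥ j }, and u(j) = max{u⁺(j), u⁻(j)}. Then: (i) u⁻ satisfies the forward sweep recursion u⁻(0) = g(0), u⁻(j+1) = min{u⁻(j), g(j+1)}, and u⁺ satisfies the backward sweep recursion u⁺(N) = g(N), u⁺(j−1) = min{u⁺(j), g(j−1)}; (ii) u ≤ g; (iii) u is discretely quasiconvex, i.e., u(k) ≤ max{u(i), u(j)} whenever i ≤ k ≤ j; and (iv) u is the largest such function: any v : {0,…,N} → ℝ with v ≤ g and v(k) ≤ max{v(i), v(j)} for all i ≤ k ≤ j satisfies v ≤ u. -/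
/-- discrete quasiconvex envelope on the grid `{0, 1, …, N}`.
With `u⁻(j) = min { g i : i ≤ j }`, `u⁺(j) = min { g i : j ≤ i ≤ N }` and
`u = max {u⁺, u⁻}`: (i) `u⁻` and `u⁺` satisfy the forward/backward sweep
recursions; (ii) `u ≤ g`; (iii) `u` is discretely quasiconvex; (iv) `u` is the
largest discretely quasiconvex function majorized by `g`. -/
theorem discrete_qce (N : ℕ) (g : ℕ → ℝ) (um up u : ℕ → ℝ)
    (hum : ∀ j : ℕ, j ≤ N → um j = (Finset.Iic j).inf' Finset.nonempty_Iic g)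
    (hup : ∀ j : ℕ, ∀ hj : j ≤ N, up j = (Finset.Icc j N).inf' (Finset.nonempty_Icc.mpr hj) g)
    (hu : ∀ j : ℕ, j ≤ N → u j = max (up j) (um j)) :
    (um 0 = g 0 ∧ (∀ j : ℕ, j + 1 ≤ N → um (j + 1) = min (um j) (g (j + 1))) ∧
      up N = g N ∧ (∀ j : ℕ, 1 ≤ j → j ≤ N → up (j - 1) = min (up j) (g (j - 1)))) ∧
    (∀ j : ℕ, j ≤ N → u j ≤ g j) ∧
    (∀ i k j : ℕ, i ≤ k → k ≤ j → j ≤ N → u k ≤ max (u i) (u j)) ∧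
    (∀ v : ℕ → ℝ, (∀ j : ℕ, j ≤ N → v j ≤ g j) →
      (∀ i k j : ℕ, i ≤ k → k ≤ j → j ≤ N → v k ≤ max (v i) (v j)) →
      ∀ j : ℕ, j ≤ N → v j ≤ u j) := by
  have le_um : ∀ j, j ≤ N → ∀ c, c ≤ um j ↔ ∀ i, i ≤ j → c ≤ g i := by
    intro j hj c
    rw [hum j hj, Finset.le_inf'_iff]
    simp only [Finset.mem_Iic]
  have le_up : ∀ j, j ≤ N → ∀ c, c ≤ up j ↔ ∀ i, j ≤ i → i ≤ N → c ≤ g i := by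
    intro j hj c
    rw [hup j hj, Finset.le_inf'_iff]
    simp only [Finset.mem_Icc, and_imp]
  have um_le : ∀ i j, i ≤ j → j ≤ N → um j ≤ g i := fun i j hij hj =>
    (le_um j hj _).1 le_rfl i hij
  have up_le : ∀ i j, j ≤ i → i ≤ N → up j ≤ g i := fun i j hji hi =>
    (le_up j (hji.trans hi) _).1 le_rfl i hji hi
  refine ⟨⟨?_, ?_, ?_, ?_⟩, ?_, ?_, ?_⟩
  · refine eq_of_forall_le_iff fun c => ?_
    rw [le_um 0 (Nat.zero_le N)]
    simp
  · intro j hj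
    refine eq_of_forall_le_iff fun c => ?_
    rw [le_um _ hj, le_min_iff, le_um _ (by omega)]
    refine ⟨fun h => ⟨fun i hi => h i (by omega), h _ le_rfl⟩, fun h i hi => ?_⟩
    rcases Nat.le_succ_iff.1 hi with hi | rfl
    exacts [h.1 i hi, h.2]
  · refine eq_of_forall_le_iff fun c => ?_
    rw [le_up N le_rfl]
    exact ⟨fun h => h N le_rfl le_rfl, fun h i h₁ h₂ => le_antisymm h₁ h₂ ▸ h⟩
  · intro j hj₁ hj
    obtain ⟨m, rfl⟩ : ∃ m, j = m + 1 := ⟨j - 1, by omega⟩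
    rw [Nat.add_sub_cancel]
    refine eq_of_forall_le_iff fun c => ?_
    rw [le_up _ (by omega), le_min_iff, le_up _ hj]
    refine ⟨fun h => ⟨fun i hi => h i (by omega), h m le_rfl (by omega)⟩, fun h i hi hiN => ?_⟩
    rcases hi.eq_or_lt with rfl | hi
    exacts [h.2, h.1 i hi hiN]
  · intro j hj
    rw [hu j hj]
    exact max_le (up_le j j le_rfl hj) (um_le j j le_rfl hj)
  · intro i k j hik hkj hj
    rw [hu i (by omega), hu k (by omega), hu j hj]
    have hup_mono : up k ≤ up j := (le_up j hj _).2 fun l hl hlN => up_le l k (by omega) hlN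
    have hum_anti : um k ≤ um i :=
      (le_um i (by omega) _).2 fun l hl => um_le l k (by omega) (by omega)
    exact max_le ((hup_mono.trans (le_max_left _ _)).trans (le_max_right _ _))
      ((hum_anti.trans (le_max_right _ _)).trans (le_max_left _ _))
  · intro v hvg hv j hj
    obtain ⟨a, ha, hga⟩ := Finset.exists_mem_eq_inf' (Finset.nonempty_Iic (a := j)) g
    obtain ⟨b, hb, hgb⟩ := Finset.exists_mem_eq_inf' (Finset.nonempty_Icc.mpr hj) g
    rw [Finset.mem_Iic] at ha
    rw [Finset.mem_Icc] at hb
    rw [hu j hj, hum j hj, hup j hj, hga, hgb, max_comm]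
    exact (hv a j b ha hb.1 hb.2).trans (max_le_max (hvg a (ha.trans hj)) (hvg b hb.2))
end
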